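/- Let f : ℝ^N → ℝ be convex and L-Lipschitz (with respect to the Euclidean norm) and let med(f) be any median of f under P_κ. Then for every t ≥ 0, P_κ( |f − med(f)| ≥ t ) ≤ 4 exp(− t² / (144 L² |𝒳|²)). -/

import Mathlib

open Finset Real
open scoped Classical

noncomputable section

/-- The multislice `Ω_κ ⊆ 𝒳^N`: vectors with values in `{x ℓ}` where the value `x ℓ`
appears exactly `κ ℓ` times. -/
def multislice (L N : ℕ) (κ : Fin L → ℕ) (x : Fin L → ℝ) : Finset (Fin N → ℝ) :=
  (Fintype.piFinset fun _ : Fin N => Finset.image x Finset.univ).filter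
    (fun ω => ∀ ℓ : Fin L, (Finset.univ.filter fun i => ω i = x ℓ).card = κ ℓ)

/-- Expectation with respect to the uniform distribution on a finite set. -/
def uexpect {α : Type*} (Ω : Finset α) (f : α → ℝ) : ℝ := (∑ ω ∈ Ω, f ω) / Ω.card

/-- Probability of an event with respect to the uniform distribution on a finite set. -/
def uprob {α : Type*} (Ω : Finset α) (p : α → Prop) : ℝ :=
  ((Ω.filter p).card : ℝ) / Ω.card

/-- Entropy of a positive function with respect to the uniform distribution on a finite set. -/
def uentropy {α : Type*} (Ω : Finset α) (f : α → ℝ) : ℝ :=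
  uexpect Ω (fun a => f a * log (f a)) - uexpect Ω f * log (uexpect Ω f)

/-- The kernel `(x - y) (log x - log y)` of the entropy production. -/
def entropyProd (x y : ℝ) : ℝ := (x - y) * (log x - log y)

lemma uexpect_mono {α : Type*} {Ω : Finset α} {f g : α → ℝ} (h : ∀ a ∈ Ω, f a ≤ g a) :
    uexpect Ω f ≤ uexpect Ω g :=
  div_le_div_of_nonneg_right (Finset.sum_le_sum h) (Nat.cast_nonneg _)

lemma uexpect_congr {α : Type*} {Ω : Finset α} {f g : α → ℝ} (h : ∀ a ∈ Ω, f a = g a) :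
    uexpect Ω f = uexpect Ω g :=
  le_antisymm (uexpect_mono fun a ha => (h a ha).le) (uexpect_mono fun a ha => (h a ha).ge)

lemma uexpect_add {α : Type*} (Ω : Finset α) (f g : α → ℝ) :
    uexpect Ω (fun a => f a + g a) = uexpect Ω f + uexpect Ω g := by
  simp only [uexpect, Finset.sum_add_distrib, add_div]

lemma uexpect_sub {α : Type*} (Ω : Finset α) (f g : α → ℝ) :
    uexpect Ω (fun a => f a - g a) = uexpect Ω f - uexpect Ω g := by
  simp only [uexpect, Finset.sum_sub_distrib, sub_div]

lemma uexpect_const_mul {α : Type*} (Ω : Finset α) (c : ℝ) (f : α → ℝ) :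
    uexpect Ω (fun a => c * f a) = c * uexpect Ω f := by
  simp only [uexpect, ← Finset.mul_sum, mul_div_assoc]

lemma uexpect_mul_const {α : Type*} (Ω : Finset α) (f : α → ℝ) (c : ℝ) :
    uexpect Ω (fun a => f a * c) = uexpect Ω f * c := by
  simp only [mul_comm _ c, uexpect_const_mul]

lemma uexpect_const {α : Type*} {Ω : Finset α} (hΩ : Ω.Nonempty) (c : ℝ) :
    uexpect Ω (fun _ => c) = c := by
  have : (Ω.card : ℝ) ≠ 0 := by exact_mod_cast hΩ.card_pos.ne'
  simp only [uexpect, Finset.sum_const, nsmul_eq_mul]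
  field_simp

lemma uexpect_sum {α ι : Type*} (Ω : Finset α) (s : Finset ι) (f : ι → α → ℝ) :
    uexpect Ω (fun a => ∑ i ∈ s, f i a) = ∑ i ∈ s, uexpect Ω (f i) := by
  simp only [uexpect, Finset.sum_div]
  exact Finset.sum_comm

lemma uexpect_comm {α β : Type*} (Ω : Finset α) (Θ : Finset β) (f : α → β → ℝ) :
    uexpect Ω (fun a => uexpect Θ (f a)) = uexpect Θ (fun b => uexpect Ω (fun a => f a b)) := by
  simp only [uexpect, Finset.sum_div]
  rw [Finset.sum_comm]
  exact Finset.sum_congr rfl fun _ _ => Finset.sum_congr rfl fun _ _ => div_right_comm _ _ _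

lemma uexpect_pos {α : Type*} {Ω : Finset α} (hΩ : Ω.Nonempty) {f : α → ℝ}
    (hf : ∀ a ∈ Ω, 0 < f a) : 0 < uexpect Ω f :=
  div_pos (Finset.sum_pos hf hΩ) (by exact_mod_cast hΩ.card_pos)

lemma mul_log_sub_log_tangent {x y X Y : ℝ} (hx : 0 < x) (hy : 0 < y) (hX : 0 < X)
    (hY : 0 < Y) : x * (log X - log Y) + (x - y * (X / Y)) ≤ x * (log x - log y) := by
  have h := Real.one_sub_inv_le_log_of_pos (x := (x * Y) / (y * X)) (by positivity)
  rw [Real.log_div (by positivity) (by positivity), Real.log_mul hx.ne' hY.ne',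
    Real.log_mul hy.ne' hX.ne'] at h
  have h2 := mul_le_mul_of_nonneg_left h hx.le
  have h3 : x * (1 - (x * Y / (y * X))⁻¹) = x - y * (X / Y) := by field_simp
  linarith

/-- The log-sum inequality. -/
lemma uexpect_log_sum {α : Type*} {Ω : Finset α} (hΩ : Ω.Nonempty) {f g : α → ℝ}
    (hf : ∀ a ∈ Ω, 0 < f a) (hg : ∀ a ∈ Ω, 0 < g a) :
    uexpect Ω f * (log (uexpect Ω f) - log (uexpect Ω g)) ≤
      uexpect Ω (fun a => f a * (log (f a) - log (g a))) := by
  have hF := uexpect_pos hΩ hf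
  have hG := uexpect_pos hΩ hg
  have h := uexpect_mono fun a ha => mul_log_sub_log_tangent (hf a ha) (hg a ha) hF hG
  rw [uexpect_add, uexpect_sub, uexpect_mul_const, uexpect_mul_const,
    mul_div_cancel₀ _ hG.ne'] at h
  linarith

lemma entropyProd_uexpect_le {α : Type*} {Ω : Finset α} (hΩ : Ω.Nonempty) {f g : α → ℝ}
    (hf : ∀ a ∈ Ω, 0 < f a) (hg : ∀ a ∈ Ω, 0 < g a) :
    entropyProd (uexpect Ω f) (uexpect Ω g) ≤ uexpect Ω (fun a => entropyProd (f a) (g a)) := by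
  have h₁ := uexpect_log_sum hΩ hf hg
  have h₂ := uexpect_log_sum hΩ hg hf
  have h₃ : uexpect Ω (fun a => entropyProd (f a) (g a)) =
      uexpect Ω (fun a => f a * (log (f a) - log (g a))) +
        uexpect Ω (fun a => g a * (log (g a) - log (f a))) := by
    rw [← uexpect_add]
    congr 1
    ext a
    unfold entropyProd
    ring
  rw [h₃]
  unfold entropyProd
  linarith

/-- The entropy is at most the covariance of `f` and `log f`. -/
lemma uentropy_le_uexpect_entropyProd {α : Type*} {Ω : Finset α} (hΩ : Ω.Nonempty) {f : α → ℝ}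
    (hf : ∀ a ∈ Ω, 0 < f a) :
    uentropy Ω f ≤ uexpect Ω (fun a => uexpect Ω fun b => entropyProd (f a) (f b)) / 2 := by
  have hF := uexpect_pos hΩ hf
  have hlog : uexpect Ω (fun a => log (f a)) ≤ log (uexpect Ω f) := by
    have h := uexpect_mono (Ω := Ω) (f := fun a => log (f a))
      (g := fun a => log (uexpect Ω f) + (f a * (uexpect Ω f)⁻¹ - 1)) fun a ha => by
        have h := Real.log_le_sub_one_of_pos (x := f a * (uexpect Ω f)⁻¹)
          (mul_pos (hf a ha) (inv_pos.2 hF))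
        rw [Real.log_mul (hf a ha).ne' (inv_pos.2 hF).ne', Real.log_inv] at h
        linarith
    rw [uexpect_add, uexpect_sub, uexpect_mul_const, uexpect_const hΩ, uexpect_const hΩ,
      mul_inv_cancel₀ hF.ne'] at h
    linarith
  have hE : uexpect Ω (fun a => uexpect Ω fun b => entropyProd (f a) (f b)) =
      2 * (uexpect Ω (fun a => f a * log (f a)) -
        uexpect Ω f * uexpect Ω (fun a => log (f a))) := by
    have h : ∀ a, uexpect Ω (fun b => entropyProd (f a) (f b)) =
        f a * log (f a) - f a * uexpect Ω (fun b => log (f b)) -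
          (uexpect Ω f * log (f a) - uexpect Ω (fun b => f b * log (f b))) := fun a => by
      have : (fun b => entropyProd (f a) (f b)) = fun b =>
          f a * log (f a) - f a * log (f b) - (f b * log (f a) - f b * log (f b)) := by
        ext b
        unfold entropyProd
        ring
      rw [this, uexpect_sub, uexpect_sub, uexpect_sub, uexpect_const hΩ, uexpect_const_mul,
        uexpect_mul_const]
    simp only [h]
    rw [uexpect_sub, uexpect_sub, uexpect_sub, uexpect_mul_const, uexpect_const_mul,
      uexpect_const hΩ]
    ring
  rw [hE]
  unfold uentropy
  nlinarith

lemma sum_sum_sum_erase_eq {α : Type*} [DecidableEq α] (s : Finset α) (D : α → α → ℝ) (hD : ∀ i, D i i = 0) :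
    ∑ k ∈ s, ∑ i ∈ s.erase k, ∑ j ∈ s.erase k, D i j =
      ((s.card : ℝ) - 2) * ∑ i ∈ s, ∑ j ∈ s, D i j := by
  have h : ∀ k ∈ s, ∑ i ∈ s.erase k, ∑ j ∈ s.erase k, D i j =
      ∑ i ∈ s, ∑ j ∈ s, D i j - ∑ i ∈ s, D i k - ∑ j ∈ s, D k j := by
    intro k hk
    have h₁ : ∀ i, ∑ j ∈ s.erase k, D i j = ∑ j ∈ s, D i j - D i k := fun i =>
      Finset.sum_erase_eq_sub hk
    simp only [h₁]
    rw [Finset.sum_erase_eq_sub hk, Finset.sum_sub_distrib, hD]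
    ring
  rw [Finset.sum_congr rfl h, Finset.sum_sub_distrib, Finset.sum_sub_distrib, Finset.sum_const,
    Finset.sum_comm (f := fun k i => D i k), nsmul_eq_mul]
  ring

lemma entropyProd_nonneg {x y : ℝ} (hx : 0 < x) (hy : 0 < y) : 0 ≤ entropyProd x y := by
  unfold entropyProd
  rcases le_total x y with h | h
  · exact mul_nonneg_of_nonpos_of_nonpos (sub_nonpos.2 h) (sub_nonpos.2 (Real.log_le_log hx h))
  · exact mul_nonneg (sub_nonneg.2 h) (sub_nonneg.2 (Real.log_le_log hy h))

/-- The permutations that fix every point outside `s`. -/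
def permsOn {α : Type*} [Fintype α] [DecidableEq α] (s : Finset α) : Finset (Equiv.Perm α) :=
  Finset.univ.filter fun σ => ∀ a ∉ s, σ a = a

section PermsOn

variable {α : Type*} [Fintype α] [DecidableEq α] {s : Finset α}

lemma mem_permsOn {σ : Equiv.Perm α} : σ ∈ permsOn s ↔ ∀ a ∉ s, σ a = a := by
  simp [permsOn]

lemma permsOn_nonempty (s : Finset α) : (permsOn s).Nonempty :=
  ⟨1, mem_permsOn.2 fun _ _ => rfl⟩

lemma mul_mem_permsOn {σ τ : Equiv.Perm α} (hσ : σ ∈ permsOn s) (hτ : τ ∈ permsOn s) :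
    σ * τ ∈ permsOn s :=
  mem_permsOn.2 fun a ha => by
    rw [Equiv.Perm.mul_apply, mem_permsOn.1 hτ a ha, mem_permsOn.1 hσ a ha]

lemma inv_mem_permsOn {σ : Equiv.Perm α} (hσ : σ ∈ permsOn s) : σ⁻¹ ∈ permsOn s :=
  mem_permsOn.2 fun _ ha => Equiv.Perm.inv_eq_iff_eq.2 (mem_permsOn.1 hσ _ ha).symm

lemma swap_mem_permsOn {i j : α} (hi : i ∈ s) (hj : j ∈ s) : Equiv.swap i j ∈ permsOn s :=
  mem_permsOn.2 fun _ ha =>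
    Equiv.swap_apply_of_ne_of_ne (fun h => ha (h ▸ hi)) (fun h => ha (h ▸ hj))

lemma apply_mem_of_mem_permsOn {σ : Equiv.Perm α} (hσ : σ ∈ permsOn s) {a : α} (ha : a ∈ s) :
    σ a ∈ s := by
  by_contra h
  exact h (by rwa [σ.injective (mem_permsOn.1 hσ _ h)])

lemma mem_permsOn_erase {σ : Equiv.Perm α} {k : α} :
    σ ∈ permsOn (s.erase k) ↔ σ ∈ permsOn s ∧ σ k = k := by
  simp only [mem_permsOn, Finset.mem_erase, not_and_or, not_not]
  constructor
  · exact fun h => ⟨fun a ha => h a (Or.inr ha), h k (Or.inl rfl)⟩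
  · rintro ⟨h, hk⟩ a (rfl | ha)
    exacts [hk, h a ha]

lemma uexpect_permsOn_mul_left {τ : Equiv.Perm α} (hτ : τ ∈ permsOn s)
    (F : Equiv.Perm α → ℝ) :
    uexpect (permsOn s) (fun σ => F (τ * σ)) = uexpect (permsOn s) F := by
  unfold uexpect
  congr 1
  exact Finset.sum_bij' (fun σ _ => τ * σ) (fun σ _ => τ⁻¹ * σ)
    (fun σ hσ => mul_mem_permsOn hτ hσ) (fun σ hσ => mul_mem_permsOn (inv_mem_permsOn hτ) hσ)
    (by simp) (by simp) (by simp)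

lemma uexpect_permsOn_mul_right {τ : Equiv.Perm α} (hτ : τ ∈ permsOn s)
    (F : Equiv.Perm α → ℝ) :
    uexpect (permsOn s) (fun σ => F (σ * τ)) = uexpect (permsOn s) F := by
  unfold uexpect
  congr 1
  exact Finset.sum_bij' (fun σ _ => σ * τ) (fun σ _ => σ * τ⁻¹)
    (fun σ hσ => mul_mem_permsOn hσ hτ) (fun σ hσ => mul_mem_permsOn hσ (inv_mem_permsOn hτ))
    (by simp) (by simp) (by simp)

lemma sum_permsOn {k : α} (hk : k ∈ s) (F : Equiv.Perm α → ℝ) :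
    ∑ σ ∈ permsOn s, F σ =
      ∑ a ∈ s, ∑ ρ ∈ permsOn (s.erase k), F (Equiv.swap a k * ρ) := by
  rw [← Finset.sum_product']
  refine Finset.sum_bij' (fun σ _ => (σ k, Equiv.swap (σ k) k * σ))
    (fun p _ => Equiv.swap p.1 k * p.2) ?_ ?_ ?_ ?_ ?_
  · intro σ hσ
    have := apply_mem_of_mem_permsOn hσ hk
    simp [this, mem_permsOn_erase, mul_mem_permsOn (swap_mem_permsOn this hk) hσ]
  · rintro ⟨a, ρ⟩ h
    rw [Finset.mem_product, mem_permsOn_erase] at h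
    exact mul_mem_permsOn (swap_mem_permsOn h.1 hk) h.2.1
  · intro σ _
    simp
  · rintro ⟨a, ρ⟩ h
    rw [Finset.mem_product, mem_permsOn_erase] at h
    simp [h.2.2]
  · intro σ _
    simp

lemma card_permsOn {k : α} (hk : k ∈ s) :
    ((permsOn s).card : ℝ) = s.card * (permsOn (s.erase k)).card := by
  have := sum_permsOn hk fun _ => 1
  simpa using this

lemma uexpect_permsOn {k : α} (hk : k ∈ s) (F : Equiv.Perm α → ℝ) :
    uexpect (permsOn s) F =
      uexpect s fun a => uexpect (permsOn (s.erase k)) fun ρ => F (Equiv.swap a k * ρ) := by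
  simp only [uexpect, sum_permsOn hk F, card_permsOn hk, ← Finset.sum_div, div_div, mul_comm]

lemma uentropy_permsOn {k : α} (hk : k ∈ s) (f : Equiv.Perm α → ℝ) :
    uentropy (permsOn s) f =
      uexpect s (fun a => uentropy (permsOn (s.erase k)) fun ρ => f (Equiv.swap a k * ρ)) +
      uentropy s fun a => uexpect (permsOn (s.erase k)) fun ρ => f (Equiv.swap a k * ρ) := by
  simp only [uentropy, uexpect_permsOn hk, uexpect_sub]
  ring

/-- The contribution to the entropy of the position of a single point `k`. -/
lemma uentropy_uexpect_swap_le {k : α} (hk : k ∈ s) {f : Equiv.Perm α → ℝ}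
    (hf : ∀ σ, 0 < f σ) :
    (uentropy s fun a => uexpect (permsOn (s.erase k)) fun ρ => f (Equiv.swap a k * ρ)) ≤
      (∑ j ∈ s, uexpect (permsOn s) fun σ => entropyProd (f σ) (f (σ * Equiv.swap k j))) /
        (2 * s.card) := by
  have hne := permsOn_nonempty (s.erase k)
  refine (uentropy_le_uexpect_entropyProd ⟨k, hk⟩ fun a _ =>
    uexpect_pos hne fun _ _ => hf _).trans ?_
  have hshift : ∀ a ∈ s, ∀ b ∈ s,
      (uexpect (permsOn (s.erase k)) fun ρ => f (Equiv.swap b k * ρ)) =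
        uexpect (permsOn (s.erase k)) fun ρ => f (Equiv.swap a b * (Equiv.swap a k * ρ)) := by
    intro a ha b hb
    have hτ : Equiv.swap b k * (Equiv.swap a b * Equiv.swap a k) ∈ permsOn (s.erase k) := by
      rw [mem_permsOn_erase]
      exact ⟨mul_mem_permsOn (swap_mem_permsOn hb hk)
        (mul_mem_permsOn (swap_mem_permsOn ha hb) (swap_mem_permsOn ha hk)), by simp⟩
    rw [← uexpect_permsOn_mul_left hτ fun ρ => f (Equiv.swap b k * ρ)]
    simp only [← mul_assoc, Equiv.swap_mul_self, one_mul]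
  have hle : (uexpect s fun a => uexpect s fun b => entropyProd
      (uexpect (permsOn (s.erase k)) fun ρ => f (Equiv.swap a k * ρ))
      (uexpect (permsOn (s.erase k)) fun ρ => f (Equiv.swap b k * ρ))) ≤
      uexpect s fun a => uexpect s fun b => uexpect (permsOn (s.erase k)) fun ρ =>
        entropyProd (f (Equiv.swap a k * ρ)) (f (Equiv.swap a b * (Equiv.swap a k * ρ))) := by
    refine uexpect_mono fun a ha => uexpect_mono fun b hb => ?_
    rw [hshift a ha b hb]
    exact entropyProd_uexpect_le hne (fun _ _ => hf _) fun _ _ => hf _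
  refine (div_le_div_of_nonneg_right hle two_pos.le).trans_eq ?_
  have hcongr : (uexpect s fun a => uexpect s fun b => uexpect (permsOn (s.erase k)) fun ρ =>
      entropyProd (f (Equiv.swap a k * ρ)) (f (Equiv.swap a b * (Equiv.swap a k * ρ)))) =
      uexpect (permsOn s) fun σ => uexpect s fun j =>
        entropyProd (f σ) (f (σ * Equiv.swap k j)) := by
    rw [uexpect_permsOn hk]
    refine uexpect_congr fun a ha => ?_
    rw [uexpect_comm]
    refine uexpect_congr fun ρ hρ => ?_
    unfold uexpect
    congr 1
    rw [mem_permsOn_erase] at hρ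
    have hσ : Equiv.swap a k * ρ ∈ permsOn s := mul_mem_permsOn (swap_mem_permsOn ha hk) hρ.1
    refine Finset.sum_bij' (fun b _ => (Equiv.swap a k * ρ)⁻¹ b)
      (fun j _ => (Equiv.swap a k * ρ) j)
      (fun b hb => apply_mem_of_mem_permsOn (inv_mem_permsOn hσ) hb)
      (fun j hj => apply_mem_of_mem_permsOn hσ hj) (by simp) (by simp) fun b _ => ?_
    rw [Equiv.mul_swap_eq_swap_mul, Equiv.Perm.inv_def, Equiv.apply_symm_apply, Equiv.Perm.mul_apply, hρ.2,
      Equiv.swap_apply_right]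
  rw [hcongr, uexpect_comm]
  change (∑ j ∈ s, _) / _ / 2 = _
  rw [div_div, mul_comm 2]

/-- The modified logarithmic Sobolev inequality for random transpositions. -/
theorem uentropy_permsOn_le (s : Finset α) {f : Equiv.Perm α → ℝ} (hf : ∀ σ, 0 < f σ) :
    uentropy (permsOn s) f ≤
      (∑ i ∈ s, ∑ j ∈ s, uexpect (permsOn s) fun σ =>
        entropyProd (f σ) (f (σ * Equiv.swap i j))) / (2 * s.card) := by
  induction s using Finset.strongInduction generalizing f with
  | H s ih =>
  rcases s.eq_empty_or_nonempty with rfl | hs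
  · have : permsOn (∅ : Finset α) = {1} := by
      ext σ
      simp [mem_permsOn, Equiv.ext_iff]
    simp [this, uentropy, uexpect]
  set D : α → α → ℝ := fun i j => uexpect (permsOn s) fun σ =>
    entropyProd (f σ) (f (σ * Equiv.swap i j)) with hD
  have hD₀ : ∀ i, D i i = 0 := fun i => by
    simp only [hD, Equiv.swap_self, ← Equiv.Perm.one_def, mul_one, entropyProd, sub_self]
    simp [uexpect]
  have hT : 0 ≤ ∑ i ∈ s, ∑ j ∈ s, D i j := Finset.sum_nonneg fun i _ => Finset.sum_nonneg
    fun j _ => div_nonneg (Finset.sum_nonneg fun σ _ => entropyProd_nonneg (hf _) (hf _))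
      (Nat.cast_nonneg _)
  have hk : ∀ k ∈ s, uentropy (permsOn s) f ≤
      (∑ i ∈ s.erase k, ∑ j ∈ s.erase k, D i j) / (2 * ((s.card : ℝ) - 1)) +
        (∑ j ∈ s, D k j) / (2 * s.card) := by
    intro k hk
    rw [uentropy_permsOn hk]
    refine add_le_add ?_ (uentropy_uexpect_swap_le hk hf)
    refine (uexpect_mono fun a _ => ih _ (Finset.erase_ssubset hk)
      (f := fun ρ => f (Equiv.swap a k * ρ)) fun _ => hf _).trans_eq ?_
    have hcard : ((s.erase k).card : ℝ) = s.card - 1 := by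
      rw [Finset.card_erase_of_mem hk, Nat.cast_pred (Finset.card_pos.2 hs)]
    simp only [div_eq_mul_inv, uexpect_mul_const, uexpect_sum, hcard, hD, uexpect_permsOn hk,
      mul_assoc]
  have hsum := Finset.sum_le_sum hk
  rw [Finset.sum_const, nsmul_eq_mul, Finset.sum_add_distrib, ← Finset.sum_div, ← Finset.sum_div,
    sum_sum_sum_erase_eq s D hD₀] at hsum
  change _ ≤ (∑ i ∈ s, ∑ j ∈ s, D i j) / _
  generalize ∑ i ∈ s, ∑ j ∈ s, D i j = T at *
  have hn : 1 ≤ s.card := hs.card_pos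
  generalize uentropy (permsOn s) f = X at *
  rcases hn.eq_or_lt with h | h
  · rw [← h] at hsum ⊢
    norm_num at hsum ⊢
    exact hsum
  · have h2 : (2 : ℝ) ≤ s.card := by exact_mod_cast h
    generalize (s.card : ℝ) = n at *
    have h₁ : (n - 2) * T / (2 * (n - 1)) + T / (2 * n) ≤ T / 2 := by
      have : T / 2 - ((n - 2) * T / (2 * (n - 1)) + T / (2 * n)) = T / (2 * n * (n - 1)) := by
        have : n - 1 ≠ 0 := by linarith
        field_simp
        ring
      have : 0 ≤ T / (2 * n * (n - 1)) := div_nonneg hT (by nlinarith)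
      linarith
    rw [le_div_iff₀ (by linarith)]
    linarith

end PermsOn

/-- Herbst's argument, run on both sides of the origin. -/
lemma herbst_two_sided {F F' : ℝ → ℝ} (hF : ∀ l, HasDerivAt F (F' l) l) (hF₀ : F 0 = 0)
    {a b B : ℝ} (ha : a < 0) (hb : 0 < b)
    (h : ∀ l ∈ Set.Icc a b, l * F' l - F l ≤ B * l ^ 2 * F' l) :
    F b / b - B * F b ≤ F a / a - B * F a := by
  set Φ : ℝ → ℝ := fun l => dslope F 0 l - B * F l with hΦ
  have hval : ∀ l, l ≠ 0 → Φ l = F l / l - B * F l := fun l hl => by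
    rw [hΦ]
    simp only [dslope_of_ne _ hl, slope_def_field, hF₀, sub_zero]
  have hcont : Continuous Φ := by
    refine .sub (continuous_iff_continuousAt.2 fun l => ?_)
      (continuous_const.mul (continuous_iff_continuousAt.2 fun l => (hF l).continuousAt))
    rcases eq_or_ne l 0 with rfl | hl
    · exact continuousAt_dslope_same.2 (hF 0).differentiableAt
    · exact (continuousAt_dslope_of_ne hl).2 (hF l).continuousAt
  have hderiv : ∀ l, l ≠ 0 → HasDerivAt Φ ((F' l * l - F l * 1) / l ^ 2 - B * F' l) l :=
    fun l hl => by
      refine (((hF l).div (hasDerivAt_id l) hl).sub ((hF l).const_mul B)).congr_of_eventuallyEq ?_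
      filter_upwards [eventually_ne_nhds hl] with y hy
      rw [hval y hy]
      rfl
  have hnonpos : ∀ l ∈ Set.Icc a b, l ≠ 0 → deriv Φ l ≤ 0 := fun l hl hl₀ => by
    rw [(hderiv l hl₀).deriv, sub_nonpos, div_le_iff₀ (by positivity)]
    linarith [h l hl]
  have hanti : ∀ c d, a ≤ c → c ≤ d → d ≤ b → (d ≤ 0 ∨ 0 ≤ c) → Φ d ≤ Φ c := by
    intro c d hac hcd hdb hor
    refine antitoneOn_of_deriv_nonpos (convex_Icc c d) hcont.continuousOn ?_ ?_
      (Set.left_mem_Icc.2 hcd) (Set.right_mem_Icc.2 hcd) hcd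
    all_goals
      rw [interior_Icc]
      intro l hl
      have hl₀ : l ≠ 0 := by
        rcases hor with h | h
        exacts [(hl.2.trans_le h).ne, (h.trans_lt hl.1).ne']
    · exact (hderiv l hl₀).differentiableAt.differentiableWithinAt
    · exact hnonpos l ⟨hac.trans hl.1.le, hl.2.le.trans hdb⟩ hl₀
  rw [← hval b hb.ne', ← hval a ha.ne]
  exact (hanti 0 b ha.le hb.le le_rfl (Or.inr le_rfl)).trans
    (hanti a 0 le_rfl ha.le hb.le (Or.inl le_rfl))

lemma hasDerivAt_uexpect_exp {α : Type*} (Ω : Finset α) (g : α → ℝ) (l : ℝ) :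
    HasDerivAt (fun l => uexpect Ω fun a => exp (l * g a))
      (uexpect Ω fun a => g a * exp (l * g a)) l := by
  refine (HasDerivAt.fun_sum fun a _ => ?_).div_const _
  simpa [mul_comm] using ((hasDerivAt_id l).mul_const (g a)).exp

/-- The entropy bound `Ent (exp (l g)) ≤ 70 l² E[g exp (l g)]` makes `exp (g / 144)` and
`exp (-g / 4)` have reciprocally bounded expectations. -/
lemma uexpect_exp_mul_uexpect_exp_le_one {α : Type*} {Ω : Finset α} (hΩ : Ω.Nonempty) (g : α → ℝ)
    (h : ∀ l, |l| ≤ 1 / 4 → uentropy Ω (fun a => exp (l * g a)) ≤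
      70 * l ^ 2 * uexpect Ω (fun a => g a * exp (l * g a))) :
    (uexpect Ω fun a => exp (1 / 144 * g a)) * (uexpect Ω fun a => exp (-(1 / 4) * g a)) ≤ 1 := by
  set Z : ℝ → ℝ := fun l => uexpect Ω fun a => exp (l * g a)
  set Z' : ℝ → ℝ := fun l => uexpect Ω fun a => g a * exp (l * g a)
  have hZ : ∀ l, 0 < Z l := fun l => uexpect_pos hΩ fun _ _ => exp_pos _
  have hF : ∀ l, HasDerivAt (fun l => log (Z l)) (Z' l / Z l) l := fun l =>
    (hasDerivAt_uexpect_exp Ω g l).log (hZ l).ne'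
  have hF₀ : log (Z 0) = 0 := by simp [Z, uexpect_const hΩ]
  have key := herbst_two_sided hF hF₀ (a := -(1 / 4)) (b := 1 / 144) (B := 70) (by norm_num)
    (by norm_num) fun l hl => by
      have hent := h l (abs_le.2 ⟨hl.1, hl.2.trans (by norm_num)⟩)
      have : uentropy Ω (fun a => exp (l * g a)) = l * Z' l - Z l * log (Z l) := by
        simp only [uentropy, Real.log_exp, Z, Z']
        rw [← uexpect_const_mul]
        congr 2
        ext a
        ring
      rw [this] at hent
      have hdiv := div_le_div_of_nonneg_right hent (hZ l).le
      rw [sub_div, mul_div_cancel_left₀ _ (hZ l).ne', mul_div_assoc, mul_div_assoc] at hdiv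
      exact hdiv
  have hlog : log (Z (1 / 144)) + log (Z (-(1 / 4))) ≤ 0 := by
    norm_num at key ⊢
    linarith
  rw [← Real.log_mul (hZ _).ne' (hZ _).ne'] at hlog
  exact (Real.log_nonpos_iff (mul_pos (hZ _) (hZ _)).le).1 hlog

lemma mul_exp_sub_one_le {w : ℝ} (hw : |w| ≤ 1) : w * (exp w - 1) ≤ exp 1 * w ^ 2 := by
  have he : 1 ≤ exp 1 := Real.one_le_exp zero_le_one
  rcases le_total 0 w with h | h
  · have h₁ : exp w - 1 ≤ exp w * w := by
      have := Real.add_one_le_exp (-w)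
      rw [Real.exp_neg] at this
      have := mul_le_mul_of_nonneg_left this (exp_pos w).le
      rw [mul_inv_cancel₀ (exp_pos w).ne'] at this
      linarith
    have h₂ : exp w ≤ exp 1 := Real.exp_le_exp.2 (le_of_abs_le hw)
    nlinarith [mul_le_mul_of_nonneg_right h₂ h, mul_le_mul_of_nonneg_left h₁ h]
  · nlinarith [Real.add_one_le_exp w, sq_nonneg w]

lemma entropyProd_exp_le {u v : ℝ} (h : |u - v| ≤ 1) :
    entropyProd (exp u) (exp v) ≤ exp 1 * (u - v) ^ 2 * exp u := by
  have h₁ := mul_exp_sub_one_le (w := v - u) (by rwa [abs_sub_comm])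
  have h₂ := mul_le_mul_of_nonneg_left h₁ (exp_pos u).le
  have h₃ : exp v = exp u * exp (v - u) := by rw [← Real.exp_add]; ring_nf
  unfold entropyProd
  rw [Real.log_exp, Real.log_exp, h₃]
  linarith

lemma entropyProd_comm (x y : ℝ) : entropyProd x y = entropyProd y x := by
  unfold entropyProd
  ring

lemma entropyProd_exp_mul_le {a b l : ℝ} (hab : |a - b| ≤ 4) (hl : |l| ≤ 1 / 4) :
    entropyProd (exp (l * a)) (exp (l * b)) ≤ exp 1 * l ^ 2 *
      (max (a - b) 0 ^ 2 * exp (l * a) + max (b - a) 0 ^ 2 * exp (l * b)) := by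
  have hlab : |l * a - l * b| ≤ 1 := by
    rw [← mul_sub, abs_mul]
    nlinarith [abs_nonneg l, abs_nonneg (a - b)]
  rcases le_total b a with h | h
  · rw [max_eq_left (sub_nonneg.2 h), max_eq_right (sub_nonpos.2 h)]
    refine (entropyProd_exp_le hlab).trans_eq ?_
    ring
  · rw [max_eq_right (sub_nonpos.2 h), max_eq_left (sub_nonneg.2 h), entropyProd_comm]
    refine (entropyProd_exp_le (by rwa [abs_sub_comm])).trans_eq ?_
    ring

lemma uentropy_exp_le_of_selfBounding {α : Type*} [Fintype α] [DecidableEq α] [Nonempty α]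
    {g : Equiv.Perm α → ℝ}
    (hosc : ∀ σ i j, |g σ - g (σ * Equiv.swap i j)| ≤ 4)
    (hself : ∀ σ, ∑ i, ∑ j, max (g σ - g (σ * Equiv.swap i j)) 0 ^ 2 ≤
      16 * Fintype.card α * g σ) {l : ℝ} (hl : |l| ≤ 1 / 4) :
    uentropy Finset.univ (fun σ => exp (l * g σ)) ≤
      70 * l ^ 2 * uexpect Finset.univ (fun σ => g σ * exp (l * g σ)) := by
  have huniv : permsOn (Finset.univ : Finset α) = Finset.univ := by
    ext σ
    simp [mem_permsOn]
  have hn : (0 : ℝ) < Fintype.card α := by exact_mod_cast Fintype.card_pos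
  have hent := uentropy_permsOn_le (Finset.univ : Finset α) (f := fun σ => exp (l * g σ))
    fun _ => exp_pos _
  have hterm : ∀ i j : α, (uexpect (permsOn Finset.univ) fun σ =>
      entropyProd (exp (l * g σ)) (exp (l * g (σ * Equiv.swap i j)))) ≤
      2 * (exp 1 * l ^ 2) * uexpect (permsOn Finset.univ) fun σ =>
        max (g σ - g (σ * Equiv.swap i j)) 0 ^ 2 * exp (l * g σ) := by
    intro i j
    refine (uexpect_mono fun σ _ => entropyProd_exp_mul_le (hosc σ i j) hl).trans_eq ?_
    rw [uexpect_const_mul, uexpect_add, ← uexpect_permsOn_mul_right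
      (swap_mem_permsOn (Finset.mem_univ i) (Finset.mem_univ j))
      fun σ => max (g (σ * Equiv.swap i j) - g σ) 0 ^ 2 * exp (l * g (σ * Equiv.swap i j))]
    simp only [mul_assoc, Equiv.swap_mul_self, mul_one]
    ring
  have hsum : ∑ i : α, ∑ j : α, (uexpect (permsOn Finset.univ) fun σ =>
      entropyProd (exp (l * g σ)) (exp (l * g (σ * Equiv.swap i j)))) ≤
      2 * (exp 1 * l ^ 2) * (16 * Fintype.card α *
        uexpect (permsOn Finset.univ) fun σ => g σ * exp (l * g σ)) := by
    refine (Finset.sum_le_sum fun i _ => Finset.sum_le_sum fun j _ => hterm i j).trans ?_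
    simp only [← Finset.mul_sum, ← uexpect_sum, ← Finset.sum_mul]
    rw [← uexpect_const_mul _ (16 * _)]
    have hc : 0 ≤ 2 * (exp 1 * l ^ 2) := by positivity
    refine mul_le_mul_of_nonneg_left (uexpect_mono fun σ _ => ?_) hc
    rw [← mul_assoc]
    exact mul_le_mul_of_nonneg_right (hself σ) (exp_pos _).le
  have hpos : 0 ≤ uexpect (permsOn Finset.univ) fun σ => g σ * exp (l * g σ) :=
    div_nonneg (Finset.sum_nonneg fun σ _ => mul_nonneg (nonneg_of_mul_nonneg_right
      ((Finset.sum_nonneg fun _ _ => Finset.sum_nonneg fun _ _ => sq_nonneg _).trans (hself σ))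
      (mul_pos (by norm_num) hn)) (exp_pos _).le) (Nat.cast_nonneg _)
  rw [← huniv]
  refine (hent.trans (div_le_div_of_nonneg_right hsum (by positivity))).trans ?_
  rw [Finset.card_univ, div_le_iff₀ (by positivity)]
  have he : exp 1 * 16 ≤ 70 := by linarith [Real.exp_one_lt_d9]
  generalize uexpect (permsOn Finset.univ) (fun σ => g σ * exp (l * g σ)) = E at *
  have : 0 ≤ l ^ 2 * E * Fintype.card α := by positivity
  nlinarith

/-- A tail bound with respect to the lower deviation for self-bounding functions of a
random permutation. -/
theorem uprob_mul_uprob_le_of_selfBounding {α : Type*} [Fintype α] [DecidableEq α] [Nonempty α]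
    {g : Equiv.Perm α → ℝ}
    (hosc : ∀ σ i j, |g σ - g (σ * Equiv.swap i j)| ≤ 4)
    (hself : ∀ σ, ∑ i, ∑ j, max (g σ - g (σ * Equiv.swap i j)) 0 ^ 2 ≤
      16 * Fintype.card α * g σ) (r : ℝ) :
    uprob Finset.univ (fun σ => g σ ≤ 0) * uprob Finset.univ (fun σ => r ≤ g σ) ≤
      exp (-r / 144) := by
  have hind : ∀ p : Equiv.Perm α → Prop,
      uprob Finset.univ p = uexpect Finset.univ fun σ => if p σ then 1 else 0 := fun p => by
    simp [uprob, uexpect]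
  have h₁ : uprob Finset.univ (fun σ => g σ ≤ 0) ≤
      uexpect Finset.univ fun σ => exp (-(1 / 4) * g σ) := by
    rw [hind]
    refine uexpect_mono fun σ _ => ?_
    split_ifs with h
    · exact Real.one_le_exp (by linarith)
    · exact (exp_pos _).le
  have h₂ : uprob Finset.univ (fun σ => r ≤ g σ) ≤
      exp (-r / 144) * uexpect Finset.univ fun σ => exp (1 / 144 * g σ) := by
    rw [hind, ← uexpect_const_mul]
    refine uexpect_mono fun σ _ => ?_
    rw [← Real.exp_add]
    split_ifs with h
    · exact Real.one_le_exp (by linarith)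
    · exact (exp_pos _).le
  have h₃ := uexpect_exp_mul_uexpect_exp_le_one (Ω := (Finset.univ : Finset (Equiv.Perm α)))
    Finset.univ_nonempty g fun l hl => uentropy_exp_le_of_selfBounding hosc hself hl
  calc _ ≤ (uexpect Finset.univ fun σ => exp (-(1 / 4) * g σ)) *
        (exp (-r / 144) * uexpect Finset.univ fun σ => exp (1 / 144 * g σ)) :=
        mul_le_mul h₁ h₂ (div_nonneg (Nat.cast_nonneg _) (Nat.cast_nonneg _))
          (div_nonneg (Finset.sum_nonneg fun _ _ => (exp_pos _).le) (Nat.cast_nonneg _))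
    _ = exp (-r / 144) * ((uexpect Finset.univ fun σ => exp (1 / 144 * g σ)) *
        uexpect Finset.univ fun σ => exp (-(1 / 4) * g σ)) := by ring
    _ ≤ exp (-r / 144) := mul_le_of_le_one_right (exp_pos _).le h₃

/-- Metric projection onto a closed convex set, characterised by its variational inequality. -/
lemma exists_projection {ι : Type*} [Fintype ι] {C : Set (ι → ℝ)} (hne : C.Nonempty)
    (hclosed : IsClosed C) (hconv : Convex ℝ C) :
    ∃ p : (ι → ℝ) → ι → ℝ, ∀ v, p v ∈ C ∧ ∀ z ∈ C, ∑ i, (v i - p v i) * (z i - p v i) ≤ 0 := by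
  refine ⟨_, fun v => Classical.choose_spec (p := fun w => w ∈ C ∧
    ∀ z ∈ C, ∑ i, (v i - w i) * (z i - w i) ≤ 0) ?_⟩
  set E := EuclideanSpace ℝ ι
  have hconv' : Convex ℝ ((WithLp.ofLp : E → ι → ℝ) ⁻¹' C) :=
    hconv.linear_preimage (WithLp.linearEquiv 2 ℝ (ι → ℝ)).toLinearMap
  have hcomplete : IsComplete ((WithLp.ofLp : E → ι → ℝ) ⁻¹' C) :=
    (hclosed.preimage (PiLp.continuous_ofLp 2 fun _ : ι => ℝ)).isComplete
  obtain ⟨z, hz⟩ := hne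
  obtain ⟨w, hw, hmin⟩ := exists_norm_eq_iInf_of_complete_convex
    ⟨WithLp.toLp 2 z, hz⟩ hcomplete hconv' (WithLp.toLp 2 v)
  refine ⟨w.ofLp, hw, fun z hz => ?_⟩
  have := (norm_eq_iInf_iff_real_inner_le_zero hconv' hw).1 hmin (WithLp.toLp 2 z) hz
  simpa [PiLp.inner_apply, mul_comm] using this

lemma sqDist_sub_sqDist_le {ι : Type*} [Fintype ι] {C : Set (ι → ℝ)} {p : (ι → ℝ) → ι → ℝ}
    (hp : ∀ v, p v ∈ C ∧ ∀ z ∈ C, ∑ i, (v i - p v i) * (z i - p v i) ≤ 0) (v w : ι → ℝ) :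
    ∑ k, (v k - p v k) ^ 2 - ∑ k, (w k - p w k) ^ 2 ≤
      2 * ∑ k, (v k - p v k) * (v k - w k) := by
  have h := (hp v).2 _ (hp w).1
  have h₂ : ∑ k, (2 * ((v k - p v k) * (w k - p w k)) - (v k - p v k) ^ 2) ≤
      ∑ k, (w k - p w k) ^ 2 :=
    Finset.sum_le_sum fun k _ => by nlinarith [sq_nonneg (v k - p v k - (w k - p w k))]
  have h₃ : ∑ k, (2 * ((v k - p v k) * (w k - p w k)) - (v k - p v k) ^ 2) =
      ∑ k, (v k - p v k) ^ 2 - 2 * ∑ k, (v k - p v k) * (v k - w k) -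
        2 * ∑ k, (v k - p v k) * (p w k - p v k) := by
    simp only [Finset.mul_sum, ← Finset.sum_sub_distrib]
    exact Finset.sum_congr rfl fun k _ => by ring
  linarith

lemma sqDist_sub_sqDist_swap_le {ι : Type*} [Fintype ι] [DecidableEq ι] {C : Set (ι → ℝ)} {p : (ι → ℝ) → ι → ℝ}
    (hp : ∀ v, p v ∈ C ∧ ∀ z ∈ C, ∑ i, (v i - p v i) * (z i - p v i) ≤ 0)
    (v : ι → ℝ) (i j : ι) :
    ∑ k, (v k - p v k) ^ 2 -
        ∑ k, (v (Equiv.swap i j k) - p (v ∘ Equiv.swap i j) k) ^ 2 ≤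
      2 * (((v i - p v i) - (v j - p v j)) * (v i - v j)) := by
  refine (sqDist_sub_sqDist_le hp v (v ∘ Equiv.swap i j)).trans_eq ?_
  congr 1
  rcases eq_or_ne i j with rfl | hij
  · simp
  · rw [← Finset.sum_subset (Finset.subset_univ {i, j}), Finset.sum_pair hij]
    · simp only [Function.comp_apply, Equiv.swap_apply_left, Equiv.swap_apply_right]
      ring
    · intro k _ hk
      simp only [Finset.mem_insert, Finset.mem_singleton, not_or] at hk
      simp [Equiv.swap_apply_of_ne_of_ne hk.1 hk.2]

/-- Concentration away from a sublevel set of a convex Lipschitz function of a randomly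
permuted vector. -/
theorem uprob_perm_mul_uprob_perm_le {ι : Type*} [Fintype ι] [DecidableEq ι] [Nonempty ι]
    {ω₀ : ι → ℝ} {lo hi : ℝ} (hlt : lo < hi) (hω₀ : ∀ i, ω₀ i ∈ Set.Icc lo hi)
    {f : (ι → ℝ) → ℝ} (hconv : ConvexOn ℝ Set.univ f) {K : ℝ} (hK : 0 < K)
    (hlip : ∀ v w : ι → ℝ, |f v - f w| ≤ K * Real.sqrt (∑ i, (v i - w i) ^ 2))
    (a : ℝ) {t : ℝ} (ht : 0 ≤ t) :
    uprob Finset.univ (fun σ : Equiv.Perm ι => f (ω₀ ∘ σ) ≤ a) *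
        uprob Finset.univ (fun σ : Equiv.Perm ι => a + t ≤ f (ω₀ ∘ σ)) ≤
      exp (-(t ^ 2) / (144 * K ^ 2 * (hi - lo) ^ 2)) := by
  set C : Set (ι → ℝ) := {y | f y ≤ a} ∩ Set.Icc (fun _ => lo) (fun _ => hi) with hC
  have hmem : ∀ σ : Equiv.Perm ι, f (ω₀ ∘ σ) ≤ a → ω₀ ∘ σ ∈ C := fun σ hσ =>
    ⟨hσ, fun i => (hω₀ (σ i)).1, fun i => (hω₀ (σ i)).2⟩
  rcases C.eq_empty_or_nonempty with hemp | hne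
  · have : uprob Finset.univ (fun σ : Equiv.Perm ι => f (ω₀ ∘ σ) ≤ a) = 0 := by
      rw [uprob, Finset.filter_false_of_mem, Finset.card_empty, Nat.cast_zero, zero_div]
      exact fun σ _ hσ => by simpa [hemp] using hmem σ hσ
    rw [this, zero_mul]
    exact (exp_pos _).le
  have hcont : Continuous f := continuousOn_univ.1 (by simpa using hconv.continuousOn isOpen_univ)
  have hCconv : Convex ℝ C :=
    (by simpa using hconv.convex_le a : Convex ℝ {y | f y ≤ a}).inter (convex_Icc _ _)
  obtain ⟨p, hp⟩ := exists_projection hne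
    ((isClosed_le hcont continuous_const).inter isClosed_Icc) hCconv
  set D := hi - lo with hD
  have hDpos : 0 < D := sub_pos.2 hlt
  set φ : (ι → ℝ) → ℝ := fun v => ∑ k, (v k - p v k) ^ 2 with hφ
  have hstep : ∀ (σ : Equiv.Perm ι) (i j : ι), φ (ω₀ ∘ σ) - φ (ω₀ ∘ (σ * Equiv.swap i j)) ≤
      2 * (((ω₀ (σ i) - p (ω₀ ∘ σ) i) - (ω₀ (σ j) - p (ω₀ ∘ σ) j)) * (ω₀ (σ i) - ω₀ (σ j))) :=
    fun σ i j => sqDist_sub_sqDist_swap_le hp (ω₀ ∘ σ) i j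
  have hp_mem : ∀ v k, p v k ∈ Set.Icc lo hi := fun v k => ⟨(hp v).1.2.1 k, (hp v).1.2.2 k⟩
  have hdiff : ∀ {x y : ℝ}, x ∈ Set.Icc lo hi → y ∈ Set.Icc lo hi → |x - y| ≤ D :=
    fun hx hy => abs_le.2 ⟨by linarith [hx.1, hy.2], by linarith [hx.2, hy.1]⟩
  have hle : ∀ (σ : Equiv.Perm ι) (i j : ι),
      φ (ω₀ ∘ σ) - φ (ω₀ ∘ (σ * Equiv.swap i j)) ≤ 4 * D ^ 2 := fun σ i j => by
    refine (hstep σ i j).trans ?_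
    have h₁ := hdiff (hω₀ (σ i)) (hp_mem (ω₀ ∘ σ) i)
    have h₂ := hdiff (hω₀ (σ j)) (hp_mem (ω₀ ∘ σ) j)
    have h₃ := (abs_sub _ _).trans (add_le_add h₁ h₂)
    have h₄ := mul_le_mul h₃ (hdiff (hω₀ (σ i)) (hω₀ (σ j))) (abs_nonneg _) (by linarith)
    rw [← abs_mul] at h₄
    linarith [le_of_abs_le h₄]
  have hosc : ∀ (σ : Equiv.Perm ι) (i j : ι),
      |φ (ω₀ ∘ σ) / D ^ 2 - φ (ω₀ ∘ (σ * Equiv.swap i j)) / D ^ 2| ≤ 4 := fun σ i j => by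
    have h := hle (σ * Equiv.swap i j) i j
    rw [mul_assoc, Equiv.swap_mul_self, mul_one] at h
    rw [← sub_div, abs_div, abs_of_pos (pow_pos hDpos 2), div_le_iff₀ (pow_pos hDpos 2)]
    exact abs_le.2 ⟨by linarith, hle σ i j⟩
  have hself : ∀ σ : Equiv.Perm ι, ∑ i : ι, ∑ j : ι,
      max (φ (ω₀ ∘ σ) / D ^ 2 - φ (ω₀ ∘ (σ * Equiv.swap i j)) / D ^ 2) 0 ^ 2 ≤
        16 * Fintype.card ι * (φ (ω₀ ∘ σ) / D ^ 2) := by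
    intro σ
    set u : ι → ℝ := fun k => ω₀ (σ k) - p (ω₀ ∘ σ) k with hu
    have hterm : ∀ i j : ι, max (φ (ω₀ ∘ σ) / D ^ 2 - φ (ω₀ ∘ (σ * Equiv.swap i j)) / D ^ 2) 0 ^ 2 ≤
        8 / D ^ 2 * (u i ^ 2 + u j ^ 2) := fun i j => by
      set x := ω₀ (σ i) - ω₀ (σ j) with hx
      have hxD : x ^ 2 ≤ D ^ 2 := sq_le_sq.2 <| by
        rw [abs_of_pos hDpos]
        exact hdiff (hω₀ _) (hω₀ _)
      have h₁ : max (φ (ω₀ ∘ σ) / D ^ 2 - φ (ω₀ ∘ (σ * Equiv.swap i j)) / D ^ 2) 0 ≤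
          |2 * ((u i - u j) * x) / D ^ 2| := by
        refine max_le ?_ (abs_nonneg _)
        rw [← sub_div]
        exact (div_le_div_of_nonneg_right (hstep σ i j) (sq_nonneg D)).trans (le_abs_self _)
      have h₂ := pow_le_pow_left₀ (le_max_right _ _) h₁ 2
      rw [sq_abs] at h₂
      refine h₂.trans ?_
      rw [div_pow, div_mul_eq_mul_div, div_le_div_iff₀ (by positivity) (by positivity)]
      have h₃ : (u i - u j) ^ 2 * x ^ 2 ≤ 2 * (u i ^ 2 + u j ^ 2) * D ^ 2 :=
        mul_le_mul (by nlinarith [sq_nonneg (u i + u j)]) hxD (sq_nonneg _) (by positivity)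
      nlinarith [mul_le_mul_of_nonneg_right h₃ (sq_nonneg D)]
    refine (Finset.sum_le_sum fun i _ => Finset.sum_le_sum fun j _ => hterm i j).trans_eq ?_
    simp only [← Finset.mul_sum, Finset.sum_add_distrib, Finset.sum_const, Finset.card_univ,
      nsmul_eq_mul]
    change 8 / D ^ 2 * (_ + _ * φ (ω₀ ∘ σ)) = _
    change 8 / D ^ 2 * (_ * φ (ω₀ ∘ σ) + _) = _
    ring
  refine le_trans ?_ ((uprob_mul_uprob_le_of_selfBounding (g := fun σ => φ (ω₀ ∘ σ) / D ^ 2)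
    hosc hself (t ^ 2 / (K ^ 2 * D ^ 2))).trans_eq ?_)
  · have hmono : ∀ P Q : Equiv.Perm ι → Prop, (∀ σ, P σ → Q σ) →
        uprob Finset.univ P ≤ uprob Finset.univ Q := fun P Q h =>
      div_le_div_of_nonneg_right (by
        exact_mod_cast Finset.card_le_card (Finset.monotone_filter_right Finset.univ fun σ _ => h σ))
        (Nat.cast_nonneg _)
    refine mul_le_mul (hmono _ _ fun σ hσ => ?_) (hmono _ _ fun σ hσ => ?_)
      (div_nonneg (Nat.cast_nonneg _) (Nat.cast_nonneg _))
      (div_nonneg (Nat.cast_nonneg _) (Nat.cast_nonneg _))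
    · refine div_nonpos_of_nonpos_of_nonneg ?_ (sq_nonneg D)
      have := (hp (ω₀ ∘ σ)).2 (ω₀ ∘ σ) (hmem σ hσ)
      simpa only [← pow_two] using this
    · have h₁ : t ≤ K * √(φ (ω₀ ∘ σ)) :=
        (le_trans (by linarith [show f (p (ω₀ ∘ σ)) ≤ a from (hp (ω₀ ∘ σ)).1.1])
          (le_abs_self _)).trans (hlip (ω₀ ∘ σ) (p (ω₀ ∘ σ)))
      have h₂ := pow_le_pow_left₀ ht h₁ 2
      rw [mul_pow, Real.sq_sqrt (show 0 ≤ φ (ω₀ ∘ σ) from Finset.sum_nonneg fun _ _ => sq_nonneg _)] at h₂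
      rw [div_le_div_iff₀ (by positivity) (by positivity)]
      nlinarith [mul_le_mul_of_nonneg_right h₂ (sq_nonneg D)]
  · congr 1
    field_simp

/-- Two vectors of the multislice differ by a permutation of the coordinates. -/
lemma exists_perm_of_mem_multislice {L N : ℕ} {κ : Fin L → ℕ} {x : Fin L → ℝ} {ω ω' : Fin N → ℝ}
    (hω : ω ∈ multislice L N κ x) (hω' : ω' ∈ multislice L N κ x) :
    ∃ σ : Equiv.Perm (Fin N), ω' = ω ∘ σ := by
  simp only [multislice, Finset.mem_filter, Fintype.mem_piFinset, Finset.mem_image,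
    Finset.mem_univ, true_and] at hω hω'
  have hcard : ∀ c, Fintype.card {i // ω' i = c} = Fintype.card {i // ω i = c} := by
    intro c
    rw [Fintype.card_subtype, Fintype.card_subtype]
    by_cases hc : ∃ ℓ, x ℓ = c
    · obtain ⟨ℓ, rfl⟩ := hc
      rw [hω.2, hω'.2]
    · rw [Finset.filter_false_of_mem, Finset.filter_false_of_mem]
      · rintro i - rfl
        exact hc (hω.1 i)
      · rintro i - rfl
        exact hc (hω'.1 i)
  refine ⟨Equiv.ofFiberEquiv fun c => Fintype.equivOfCardEq (hcard c), funext fun i => ?_⟩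
  exact (Equiv.ofFiberEquiv_map _ i).symm

lemma comp_mem_multislice {L N : ℕ} {κ : Fin L → ℕ} {x : Fin L → ℝ} {ω : Fin N → ℝ}
    (hω : ω ∈ multislice L N κ x) (σ : Equiv.Perm (Fin N)) : ω ∘ σ ∈ multislice L N κ x := by
  simp only [multislice, Finset.mem_filter, Fintype.mem_piFinset] at hω ⊢
  refine ⟨fun i => hω.1 (σ i), fun ℓ => ?_⟩
  rw [← hω.2 ℓ]
  exact Finset.card_bij (fun i _ => σ i) (by simp) (by simp)
    fun i hi => ⟨σ.symm i, by simpa using hi, by simp⟩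

/-- A uniformly permuted vector of the multislice is uniformly distributed. -/
lemma uprob_multislice_eq {L N : ℕ} {κ : Fin L → ℕ} {x : Fin L → ℝ} {ω₀ : Fin N → ℝ}
    (hω₀ : ω₀ ∈ multislice L N κ x) (P : (Fin N → ℝ) → Prop) :
    uprob (multislice L N κ x) P =
      uprob Finset.univ fun σ : Equiv.Perm (Fin N) => P (ω₀ ∘ σ) := by
  set F : (Fin N → ℝ) → ℝ := fun ω => if P ω then 1 else 0
  have hl : uprob (multislice L N κ x) P = uexpect (multislice L N κ x) F := by
    simp [uprob, uexpect, F]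
  have hr : (uprob Finset.univ fun σ : Equiv.Perm (Fin N) => P (ω₀ ∘ σ)) =
      uexpect Finset.univ fun σ : Equiv.Perm (Fin N) => F (ω₀ ∘ σ) := by
    simp [uprob, uexpect, F]
  have hinv : ∀ σ : Equiv.Perm (Fin N),
      uexpect (multislice L N κ x) (fun ω => F (ω ∘ σ)) = uexpect (multislice L N κ x) F := by
    intro σ
    unfold uexpect
    congr 1
    exact Finset.sum_bij' (fun ω _ => ω ∘ σ) (fun ω _ => ω ∘ σ.symm)
      (fun ω hω => comp_mem_multislice hω σ) (fun ω hω => comp_mem_multislice hω σ.symm)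
      (fun ω _ => by ext; simp) (fun ω _ => by ext; simp) fun _ _ => rfl
  have htrans : ∀ ω ∈ multislice L N κ x,
      (uexpect Finset.univ fun σ : Equiv.Perm (Fin N) => F (ω ∘ σ)) =
        uexpect Finset.univ fun σ : Equiv.Perm (Fin N) => F (ω₀ ∘ σ) := by
    intro ω hω
    obtain ⟨τ, rfl⟩ := exists_perm_of_mem_multislice hω₀ hω
    unfold uexpect
    congr 1
    exact Fintype.sum_equiv (Equiv.mulLeft τ) _ _ fun σ => rfl
  rw [hl, hr, ← uexpect_const ⟨ω₀, hω₀⟩ (uexpect Finset.univ _), ← uexpect_congr htrans,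
    uexpect_comm, uexpect_congr fun σ _ => hinv σ, uexpect_const Finset.univ_nonempty]

lemma uprob_le_add {α : Type*} {Ω : Finset α} {p q r : α → Prop} (h : ∀ a, p a → q a ∨ r a) :
    uprob Ω p ≤ uprob Ω q + uprob Ω r := by
  rw [uprob, uprob, uprob, ← add_div]
  refine div_le_div_of_nonneg_right ?_ (Nat.cast_nonneg _)
  norm_cast
  refine (Finset.card_le_card (Finset.monotone_filter_right Ω fun a _ => h a)).trans ?_
  rw [Finset.filter_or]
  exact Finset.card_union_le _ _

/-- Concentration of convex Lipschitz functions around a median on the multislice. -/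
theorem stmt9 (L N : ℕ) (hL : 2 ≤ L) (κ : Fin L → ℕ) (hκ : ∀ ℓ, 1 ≤ κ ℓ)
    (hN : N = ∑ ℓ, κ ℓ) (x : Fin L → ℝ) (hx : StrictMono x)
    (f : (Fin N → ℝ) → ℝ) (hconv : ConvexOn ℝ Set.univ f)
    (K : ℝ) (hK : 0 ≤ K)
    (hlip : ∀ v w : Fin N → ℝ, |f v - f w| ≤ K * Real.sqrt (∑ i, (v i - w i) ^ 2))
    (m : ℝ)
    (hm₁ : uprob (multislice L N κ x) (fun ω => f ω ≤ m) ≥ 1 / 2)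
    (hm₂ : uprob (multislice L N κ x) (fun ω => f ω ≥ m) ≥ 1 / 2)
    (t : ℝ) (ht : 0 ≤ t) :
    uprob (multislice L N κ x) (fun ω => |f ω - m| ≥ t) ≤
      4 * Real.exp (-(t ^ 2) /
        (144 * K ^ 2 * (x ⟨L - 1, by omega⟩ - x ⟨0, by omega⟩) ^ 2)) := by
  have hle_one : uprob (multislice L N κ x) (fun ω => |f ω - m| ≥ t) ≤ 1 :=
    div_le_one_of_le₀ (by exact_mod_cast Finset.card_filter_le _ _) (Nat.cast_nonneg _)
  rcases hK.eq_or_lt with rfl | hK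
  · refine hle_one.trans ?_
    norm_num
  obtain ⟨ω₀, hω₀⟩ : (multislice L N κ x).Nonempty := by
    by_contra h
    rw [Finset.not_nonempty_iff_eq_empty] at h
    norm_num [h, uprob] at hm₁
  have hN₀ : 0 < N := by
    rw [hN]
    exact Finset.sum_pos (fun ℓ _ => hκ ℓ) ⟨⟨0, by omega⟩, Finset.mem_univ _⟩
  have : Nonempty (Fin N) := ⟨⟨0, hN₀⟩⟩
  have hlt : x ⟨0, by omega⟩ < x ⟨L - 1, by omega⟩ := hx (Fin.mk_lt_mk.2 (by omega))
  have hbound : ∀ i, ω₀ i ∈ Set.Icc (x ⟨0, by omega⟩) (x ⟨L - 1, by omega⟩) := fun i => by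
    have := Fintype.mem_piFinset.1 (Finset.mem_filter.1 hω₀).1 i
    obtain ⟨ℓ, -, h⟩ := Finset.mem_image.1 this
    rw [← h]
    exact ⟨hx.monotone (Fin.mk_le_mk.2 (Nat.zero_le _)),
      hx.monotone (Fin.mk_le_mk.2 (by have := ℓ.2; omega))⟩
  have key : ∀ a, uprob (multislice L N κ x) (fun ω => f ω ≤ a) *
      uprob (multislice L N κ x) (fun ω => a + t ≤ f ω) ≤ exp (-(t ^ 2) /
        (144 * K ^ 2 * (x ⟨L - 1, by omega⟩ - x ⟨0, by omega⟩) ^ 2)) := fun a => by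
    rw [uprob_multislice_eq hω₀, uprob_multislice_eq hω₀]
    exact uprob_perm_mul_uprob_perm_le hlt hbound hconv hK hlip a ht
  have hup := key m
  have hlow := key (m - t)
  rw [sub_add_cancel] at hlow
  refine (uprob_le_add (q := fun ω => m + t ≤ f ω) (r := fun ω => f ω ≤ m - t)
    fun ω hω => ?_).trans ?_
  · rcases le_abs.1 hω with h | h
    · exact Or.inl (by linarith)
    · exact Or.inr (by linarith)
  · have hnn : ∀ P, 0 ≤ uprob (multislice L N κ x) P := fun P =>
      div_nonneg (Nat.cast_nonneg _) (Nat.cast_nonneg _)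
    have h₁ := mul_le_mul_of_nonneg_right hm₁ (hnn fun ω => m + t ≤ f ω)
    have h₂ := mul_le_mul_of_nonneg_left hm₂ (hnn fun ω => f ω ≤ m - t)
    simp only [ge_iff_le] at h₁ h₂
    linarith
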